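/- Let M, N, K be positive integers, A ∈ ℝ^{M×N}, 𝓛 ∈ ℝ^{M×M} and μ₀ > 0. Define g(U,Z) = (1/2)‖A − UZ‖_F² + (μ₀/2)·tr(Uᵀ𝓛U) for U ∈ ℝ^{M×K}, Z ∈ ℝ^{K×N}, and the kernel h_c(U,Z) = 3·((‖U‖_F² + ‖Z‖_F²)/2)² + (‖A‖_F + μ₀‖𝓛‖_F)·(‖U‖_F² + ‖Z‖_F²)/2. Then there exists a constant L ≥ 1 such that both (U,Z) ↦ L·h_c(U,Z) − g(U,Z) and (U,Z) ↦ L·h_c(U,Z) + g(U,Z) are convex on ℝ^{M×K} × ℝ^{K×N}. -/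

import Mathlib

open Matrix

/-- Frobenius inner product of real matrices. -/
noncomputable def fip {m n : ℕ} (X Y : Matrix (Fin m) (Fin n) ℝ) : ℝ :=
  ∑ i, ∑ j, X i j * Y i j

/-- Frobenius norm of a real matrix. -/
noncomputable def fnorm {m n : ℕ} (X : Matrix (Fin m) (Fin n) ℝ) : ℝ :=
  Real.sqrt (fip X X)

theorem convexOn_univ_of_exists_subgradient {E : Type*} [AddCommGroup E] [Module ℝ E]
    {f : E → ℝ} (h : ∀ x, ∃ l : E →ₗ[ℝ] ℝ, ∀ d, f x + l d ≤ f (x + d)) :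
    ConvexOn ℝ Set.univ f := by
  refine ⟨convex_univ, ?_⟩
  intro x _ y _ a b ha hb hab
  obtain ⟨l, hl⟩ := h (a • x + b • y)
  have hx := hl (x - (a • x + b • y))
  have hy := hl (y - (a • x + b • y))
  rw [add_sub_cancel] at hx hy
  simp only [map_sub, map_add, map_smul, smul_eq_mul] at hx hy ⊢
  have hx' := mul_le_mul_of_nonneg_left hx ha
  have hy' := mul_le_mul_of_nonneg_left hy hb
  obtain rfl : b = 1 - a := by linarith
  linarith

section Frobenius

variable {m n k : ℕ}

theorem fip_comm (X Y : Matrix (Fin m) (Fin n) ℝ) : fip X Y = fip Y X := by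
  simp only [fip, mul_comm]

theorem fip_add_left (X Y Z : Matrix (Fin m) (Fin n) ℝ) :
    fip (X + Y) Z = fip X Z + fip Y Z := by
  simp only [fip, Matrix.add_apply, add_mul, Finset.sum_add_distrib]

theorem fip_smul_left (c : ℝ) (X Y : Matrix (Fin m) (Fin n) ℝ) :
    fip (c • X) Y = c * fip X Y := by
  simp only [fip, Matrix.smul_apply, smul_eq_mul, Finset.mul_sum, mul_assoc]

theorem fip_sub_left (X Y Z : Matrix (Fin m) (Fin n) ℝ) :
    fip (X - Y) Z = fip X Z - fip Y Z := by
  simp only [fip, Matrix.sub_apply, sub_mul, Finset.sum_sub_distrib]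

theorem fip_add_right (X Y Z : Matrix (Fin m) (Fin n) ℝ) :
    fip X (Y + Z) = fip X Y + fip X Z := by
  simp only [fip_comm X, fip_add_left]

theorem fip_smul_right (c : ℝ) (X Y : Matrix (Fin m) (Fin n) ℝ) :
    fip X (c • Y) = c * fip X Y := by
  simp only [fip_comm X, fip_smul_left]

theorem fip_sub_right (X Y Z : Matrix (Fin m) (Fin n) ℝ) :
    fip X (Y - Z) = fip X Y - fip X Z := by
  simp only [fip_comm X, fip_sub_left]

theorem fip_self_nonneg (X : Matrix (Fin m) (Fin n) ℝ) : 0 ≤ fip X X :=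
  Finset.sum_nonneg fun _ _ => Finset.sum_nonneg fun _ _ => mul_self_nonneg _

theorem fnorm_nonneg (X : Matrix (Fin m) (Fin n) ℝ) : 0 ≤ fnorm X := Real.sqrt_nonneg _

theorem fnorm_sq (X : Matrix (Fin m) (Fin n) ℝ) : fnorm X ^ 2 = fip X X :=
  Real.sq_sqrt (fip_self_nonneg X)

theorem abs_fip_le (X Y : Matrix (Fin m) (Fin n) ℝ) : |fip X Y| ≤ fnorm X * fnorm Y := by
  apply abs_le_of_sq_le_sq _ (mul_nonneg (fnorm_nonneg X) (fnorm_nonneg Y))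
  rw [mul_pow, fnorm_sq, fnorm_sq]
  simp only [fip, ← Fintype.sum_prod_type', ← pow_two]
  exact Finset.sum_mul_sq_le_sq_mul_sq _ _ _

attribute [local instance] Matrix.frobeniusNormedAddCommGroup in
theorem fnorm_mul_le (X : Matrix (Fin m) (Fin n) ℝ) (Y : Matrix (Fin n) (Fin k) ℝ) :
    fnorm (X * Y) ≤ fnorm X * fnorm Y := by
  have key {a b : ℕ} (W : Matrix (Fin a) (Fin b) ℝ) : fnorm W = ‖W‖ := by
    rw [Matrix.frobenius_norm_def, ← Real.sqrt_eq_rpow]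
    simp [fnorm, fip, pow_two]
  simp only [key]
  exact Matrix.frobenius_norm_mul X Y

theorem fnorm_add_sq_le (X Y : Matrix (Fin m) (Fin n) ℝ) :
    fnorm (X + Y) ^ 2 ≤ (fnorm X + fnorm Y) ^ 2 := by
  have h := (abs_le.1 (abs_fip_le X Y)).2
  have hX := fnorm_sq X
  have hY := fnorm_sq Y
  simp only [fnorm_sq (X + Y), fip_add_left, fip_add_right, fip_comm Y X]
  nlinarith

theorem trace_transpose_mul_mul (L : Matrix (Fin m) (Fin m) ℝ) (U : Matrix (Fin m) (Fin n) ℝ) :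
    Matrix.trace (Uᵀ * L * U) = fip U (L * U) := by
  rw [Matrix.mul_assoc, fip, Finset.sum_comm]
  simp only [Matrix.trace, Matrix.diag, Matrix.mul_apply, Matrix.transpose_apply]

end Frobenius

/-- The remainder of the first-order expansion of `g` is dominated by three times that of the
kernel: here `u, z, h, w` are the norms of the blocks `U, Z` of the base point and `H, W` of the
increment, `q` is the increment of `(‖U‖² + ‖Z‖²) / 2`, and `P, Q, r, t` are the terms of the
remainder of `g`. -/
theorem abs_remainder_le {a l μ u z h w q i P Q r t : ℝ} (ha : 0 ≤ a) (hl : 0 ≤ l) (hμ : 0 ≤ μ)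
    (hh : 0 ≤ h) (hw : 0 ≤ w)
    (hq : q = i + (h ^ 2 + w ^ 2) / 2) (hi : |i| ≤ u * h + z * w)
    (hP0 : 0 ≤ P) (hP : P ≤ (h * z + u * w + h * w) ^ 2)
    (hr : |r| ≤ a * (h * w)) (hQ : |Q| ≤ u * z * (h * w)) (ht : |t| ≤ l * h ^ 2) :
    |P / 2 - (r - Q) + μ / 2 * t| ≤
      3 * (3 * q ^ 2 + 3 / 2 * ((u ^ 2 + z ^ 2) * (h ^ 2 + w ^ 2)) +
        (a + μ * l) * ((h ^ 2 + w ^ 2) / 2)) := by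
  have hi2 : i ^ 2 ≤ (u ^ 2 + z ^ 2) * (h ^ 2 + w ^ 2) := by
    have := sq_le_sq' (abs_le.1 hi).1 (abs_le.1 hi).2
    nlinarith [sq_nonneg (u * w - z * h)]
  have hd : ((h ^ 2 + w ^ 2) / 2) ^ 2 ≤ 2 * q ^ 2 + 2 * i ^ 2 := by
    rw [hq]; nlinarith [sq_nonneg (2 * i + (h ^ 2 + w ^ 2) / 2)]
  have hhw : h * w ≤ (h ^ 2 + w ^ 2) / 2 := by nlinarith [sq_nonneg (h - w)]
  have huz : u * z ≤ (u ^ 2 + z ^ 2) / 2 := by nlinarith [sq_nonneg (u - z)]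
  have hhw0 := mul_nonneg hh hw
  have hhw2 : (h * w) ^ 2 ≤ ((h ^ 2 + w ^ 2) / 2) ^ 2 := by gcongr
  have hP1 : P / 2 ≤ (u ^ 2 + z ^ 2) * (h ^ 2 + w ^ 2) + ((h ^ 2 + w ^ 2) / 2) ^ 2 := by
    nlinarith [sq_nonneg (h * z + u * w - h * w), sq_nonneg (h * u - z * w)]
  have hr1 : a * (h * w) ≤ a * ((h ^ 2 + w ^ 2) / 2) := by gcongr
  have hQ1 : u * z * (h * w) ≤ (u ^ 2 + z ^ 2) / 2 * ((h ^ 2 + w ^ 2) / 2) := by gcongr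
  have ht1 : |μ / 2 * t| ≤ μ * l * ((h ^ 2 + w ^ 2) / 2) := by
    rw [abs_mul, abs_of_nonneg (by positivity)]
    have h1 := mul_le_mul_of_nonneg_left ht (show 0 ≤ μ / 2 by positivity)
    have h2 : 0 ≤ μ * l * w ^ 2 := by positivity
    linarith
  have h0 : 0 ≤ (u ^ 2 + z ^ 2) * (h ^ 2 + w ^ 2) := by positivity
  have h1 : 0 ≤ a * ((h ^ 2 + w ^ 2) / 2) := by positivity
  have h2 : 0 ≤ μ * l * ((h ^ 2 + w ^ 2) / 2) := by positivity
  have h3 := sq_nonneg q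
  rw [abs_le] at *
  constructor <;> linarith [hr.1, hr.2, hQ.1, hQ.2, ht1.1, ht1.2]

theorem convexOn_kernel_add_smul {M N K : ℕ}
    (A : Matrix (Fin M) (Fin N) ℝ) (𝓛 : Matrix (Fin M) (Fin M) ℝ)
    {μ₀ : ℝ} (hμ₀ : 0 ≤ μ₀) {ε : ℝ} (hε : |ε| ≤ 1) :
    ConvexOn ℝ Set.univ
      (fun p : Matrix (Fin M) (Fin K) ℝ × Matrix (Fin K) (Fin N) ℝ =>
        3 * (3 * ((fnorm p.1 ^ 2 + fnorm p.2 ^ 2) / 2) ^ 2 +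
             (fnorm A + μ₀ * fnorm 𝓛) * ((fnorm p.1 ^ 2 + fnorm p.2 ^ 2) / 2)) +
        ε * ((1 / 2) * fnorm (A - p.1 * p.2) ^ 2 +
          (μ₀ / 2) * Matrix.trace (p.1ᵀ * 𝓛 * p.1))) := by
  apply convexOn_univ_of_exists_subgradient
  rintro ⟨U, Z⟩
  refine ⟨{
    toFun := fun d =>
      3 * (3 * (fip U U + fip Z Z) + (fnorm A + μ₀ * fnorm 𝓛)) * (fip U d.1 + fip Z d.2) +
        ε * (-fip (A - U * Z) (d.1 * Z + U * d.2) +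
          μ₀ / 2 * (fip U (𝓛 * d.1) + fip d.1 (𝓛 * U)))
    map_add' := fun d e => by
      simp only [Prod.fst_add, Prod.snd_add, Matrix.add_mul, Matrix.mul_add, fip_add_left,
        fip_add_right]
      ring
    map_smul' := fun c d => by
      simp only [Prod.smul_fst, Prod.smul_snd, Matrix.smul_mul, Matrix.mul_smul, fip_add_right,
        fip_smul_left, fip_smul_right, smul_eq_mul, RingHom.id_apply]
      ring }, ?_⟩
  rintro ⟨H, W⟩
  have hi : |fip U H + fip Z W| ≤ fnorm U * fnorm H + fnorm Z * fnorm W :=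
    (abs_add_le _ _).trans (add_le_add (abs_fip_le _ _) (abs_fip_le _ _))
  have hP : fnorm (H * Z + U * W + H * W) ^ 2 ≤
      (fnorm H * fnorm Z + fnorm U * fnorm W + fnorm H * fnorm W) ^ 2 := by
    have h1 := abs_le_of_sq_le_sq (fnorm_add_sq_le (H * Z + U * W) (H * W))
      (add_nonneg (fnorm_nonneg _) (fnorm_nonneg _))
    have h2 := abs_le_of_sq_le_sq (fnorm_add_sq_le (H * Z) (U * W))
      (add_nonneg (fnorm_nonneg _) (fnorm_nonneg _))
    refine pow_le_pow_left₀ (fnorm_nonneg _) ?_ 2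
    linarith [le_abs_self (fnorm (H * Z + U * W + H * W)), le_abs_self (fnorm (H * Z + U * W)),
      fnorm_mul_le H Z, fnorm_mul_le U W, fnorm_mul_le H W]
  have hr : |fip A (H * W)| ≤ fnorm A * (fnorm H * fnorm W) :=
    (abs_fip_le _ _).trans (mul_le_mul_of_nonneg_left (fnorm_mul_le _ _) (fnorm_nonneg _))
  have hQ : |fip (U * Z) (H * W)| ≤ fnorm U * fnorm Z * (fnorm H * fnorm W) :=
    (abs_fip_le _ _).trans (mul_le_mul (fnorm_mul_le _ _) (fnorm_mul_le _ _) (fnorm_nonneg _)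
      (mul_nonneg (fnorm_nonneg _) (fnorm_nonneg _)))
  have ht : |fip H (𝓛 * H)| ≤ fnorm 𝓛 * fnorm H ^ 2 := by
    have := mul_le_mul_of_nonneg_left (fnorm_mul_le 𝓛 H) (fnorm_nonneg H)
    exact ((abs_fip_le _ _).trans this).trans_eq (by ring)
  have key := abs_remainder_le (fnorm_nonneg A) (fnorm_nonneg 𝓛) hμ₀ (fnorm_nonneg H)
    (fnorm_nonneg W) rfl hi (sq_nonneg _) hP hr hQ ht
  have hrem := (abs_le.1 ((abs_mul ε _).trans_le
    ((mul_le_of_le_one_left (abs_nonneg _) hε).trans key))).1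
  have hR : A - (U + H) * (Z + W) = (A - U * Z) - (H * Z + U * W + H * W) := by
    simp only [Matrix.add_mul, Matrix.mul_add]
    abel
  have hg : (1 / 2) * fnorm (A - (U + H) * (Z + W)) ^ 2 +
      (μ₀ / 2) * Matrix.trace ((U + H)ᵀ * 𝓛 * (U + H)) =
      (1 / 2) * fnorm (A - U * Z) ^ 2 + (μ₀ / 2) * Matrix.trace (Uᵀ * 𝓛 * U) +
      (-fip (A - U * Z) (H * Z + U * W) + μ₀ / 2 * (fip U (𝓛 * H) + fip H (𝓛 * U))) +
      (fnorm (H * Z + U * W + H * W) ^ 2 / 2 - (fip A (H * W) - fip (U * Z) (H * W)) +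
        μ₀ / 2 * fip H (𝓛 * H)) := by
    rw [hR]
    generalize H * Z + U * W = P
    rw [← fip_sub_left]
    generalize A - U * Z = R
    simp only [trace_transpose_mul_mul]
    simp only [Matrix.mul_add, fnorm_sq, fip_add_left, fip_add_right,
      fip_sub_left, fip_sub_right, fip_comm P R, fip_comm (H * W) R, fip_comm (H * W) P]
    ring
  simp only [Prod.mk_add_mk, LinearMap.coe_mk, AddHom.coe_mk]
  rw [hg]
  simp only [fnorm_sq U, fnorm_sq Z, fnorm_sq H, fnorm_sq W, fnorm_sq (U + H), fnorm_sq (Z + W),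
    fip_add_left, fip_add_right, fip_comm H U, fip_comm W Z] at hrem ⊢
  linarith

/-- for g(U,Z) = ½‖A − UZ‖_F² + (μ₀/2) tr(Uᵀ𝓛U) and kernel
h_c(U,Z) = 3((‖U‖²+‖Z‖²)/2)² + (‖A‖_F + μ₀‖𝓛‖_F)(‖U‖²+‖Z‖²)/2, there is L ≥ 1 such
that both L·h_c − g and L·h_c + g are convex. -/
theorem stmt9 (M N K : ℕ) (hM : 0 < M) (hN : 0 < N) (hK : 0 < K)
    (A : Matrix (Fin M) (Fin N) ℝ) (𝓛 : Matrix (Fin M) (Fin M) ℝ)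
    (μ₀ : ℝ) (hμ₀ : 0 < μ₀) :
    ∃ L : ℝ, 1 ≤ L ∧
      ConvexOn ℝ Set.univ
        (fun p : Matrix (Fin M) (Fin K) ℝ × Matrix (Fin K) (Fin N) ℝ =>
          L * (3 * ((fnorm p.1 ^ 2 + fnorm p.2 ^ 2) / 2) ^ 2 +
               (fnorm A + μ₀ * fnorm 𝓛) * ((fnorm p.1 ^ 2 + fnorm p.2 ^ 2) / 2)) -
          ((1 / 2) * fnorm (A - p.1 * p.2) ^ 2 +
            (μ₀ / 2) * Matrix.trace (p.1ᵀ * 𝓛 * p.1))) ∧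
      ConvexOn ℝ Set.univ
        (fun p : Matrix (Fin M) (Fin K) ℝ × Matrix (Fin K) (Fin N) ℝ =>
          L * (3 * ((fnorm p.1 ^ 2 + fnorm p.2 ^ 2) / 2) ^ 2 +
               (fnorm A + μ₀ * fnorm 𝓛) * ((fnorm p.1 ^ 2 + fnorm p.2 ^ 2) / 2)) +
          ((1 / 2) * fnorm (A - p.1 * p.2) ^ 2 +
            (μ₀ / 2) * Matrix.trace (p.1ᵀ * 𝓛 * p.1))) := by
  refine ⟨3, by norm_num, ?_, ?_⟩
  · simpa only [neg_one_mul, ← sub_eq_add_neg] using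
      convexOn_kernel_add_smul A 𝓛 hμ₀.le (ε := -1) (by simp)
  · simpa only [one_mul] using convexOn_kernel_add_smul A 𝓛 hμ₀.le (ε := 1) (by simp)
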